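/- Let n ≥ 1 and T > 0. Let A be a real n×n matrix, B̄ ∈ ℝⁿ, Q̄ : [0,T] → ℝ^{n×n} continuous with each Q̄(t) symmetric, R : [0,T] → ℝ continuous with R(t) > 0, and r : [0,T] → ℝⁿ continuous. Let P : [0,T] → ℝ^{n×n} be differentiable with each P(t) symmetric, P(T) = 0, and P′(t) = −AᵀP(t) − P(t)A − Q̄(t) + R(t)⁻¹ (P(t)B̄)(P(t)B̄)ᵀ, and let φ : [0,T] → ℝⁿ be differentiable with φ(T) = 0 and φ′(t) = R(t)⁻¹ (B̄·φ(t))(P(t)B̄) − Aᵀφ(t) − P(t)r(t). Fix y₀ ∈ ℝⁿ. Suppose (Y,V) and (Y*,V*) are two pairs with V, V* : [0,T] → ℝ continuous, Y, Y* : [0,T] → ℝⁿ differentiable, Y′ = AY + V·B̄ + r, Y*′ = AY* + V*·B̄ + r, Y(0) = Y*(0) = y₀, and the second pair satisfies the feedback law V*(t) = −R(t)⁻¹ B̄·(P(t)Y*(t) + φ(t)) for all t. Then ∫₀^T ( Y(t)·(Q̄(t)Y(t)) + R(t)V(t)² ) dt ≥ ∫₀^T ( Y*(t)·(Q̄(t)Y*(t))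 + R(t)V*(t)² ) dt. -/

import Mathlib

open Matrix MeasureTheory intervalIntegral

attribute [local instance] Matrix.normedAddCommGroup Matrix.normedSpace

section RiccatiVerification

variable {m n : Type*} [Fintype n]

theorem HasDerivWithinAt.dotProduct {u v : ℝ → n → ℝ} {u' v' : n → ℝ} {s : Set ℝ} {t : ℝ}
    (hu : HasDerivWithinAt u u' s t) (hv : HasDerivWithinAt v v' s t) :
    HasDerivWithinAt (fun x => u x ⬝ᵥ v x) (u' ⬝ᵥ v t + u t ⬝ᵥ v') s t := by
  rw [hasDerivWithinAt_pi] at hu hv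
  unfold _root_.dotProduct
  rw [← Finset.sum_add_distrib]
  exact HasDerivWithinAt.fun_sum fun i _ => (hu i).mul (hv i)

theorem HasDerivWithinAt.mulVec {M : ℝ → Matrix m n ℝ} {v : ℝ → n → ℝ}
    {M' : Matrix m n ℝ} {v' : n → ℝ} {s : Set ℝ} {t : ℝ}
    (hM : HasDerivWithinAt M M' s t) (hv : HasDerivWithinAt v v' s t) :
    HasDerivWithinAt (fun x => (M x).mulVec (v x)) (M'.mulVec (v t) + (M t).mulVec v') s t := by
  rw [hasDerivWithinAt_pi]
  exact fun i => ((hasDerivWithinAt_pi (φ := fun x => (M x : m → n → ℝ))).1 hM i).dotProduct hv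

theorem Matrix.IsSymm.dotProduct_mulVec_comm {M : Matrix n n ℝ} (hM : M.IsSymm) (x y : n → ℝ) :
    x ⬝ᵥ M.mulVec y = y ⬝ᵥ M.mulVec x := by
  rw [dotProduct_mulVec, ← mulVec_transpose, hM.eq, dotProduct_comm]

/-- Completion of the square: the derivative of the value function `y ⬝ P y + 2 φ ⬝ y` along a
trajectory plus the running cost is a nonnegative square plus a term independent of the state
and the control. -/
theorem riccati_completion_of_square (A P Q : Matrix n n ℝ) (hP : P.IsSymm) (B r φ y : n → ℝ)
    (R v : ℝ) (hR : R ≠ 0) :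
    ((A.mulVec y + v • B + r) ⬝ᵥ P.mulVec y
      + y ⬝ᵥ ((-(Aᵀ * P) - P * A - Q
          + R⁻¹ • vecMulVec (P.mulVec B) (P.mulVec B)).mulVec y
          + P.mulVec (A.mulVec y + v • B + r)))
      + 2 * (((R⁻¹ * (B ⬝ᵥ φ)) • P.mulVec B - Aᵀ.mulVec φ - P.mulVec r) ⬝ᵥ y
          + φ ⬝ᵥ (A.mulVec y + v • B + r))
      + (y ⬝ᵥ Q.mulVec y + R * v ^ 2)
      = R * (v + R⁻¹ * (B ⬝ᵥ (P.mulVec y + φ))) ^ 2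
        + (2 * (φ ⬝ᵥ r) - R⁻¹ * (B ⬝ᵥ φ) ^ 2) := by
  have h₁ : y ⬝ᵥ Aᵀ.mulVec (P.mulVec y) = A.mulVec y ⬝ᵥ P.mulVec y := by
    rw [dotProduct_mulVec, vecMul_transpose]
  have h₂ : y ⬝ᵥ P.mulVec (A.mulVec y) = A.mulVec y ⬝ᵥ P.mulVec y :=
    hP.dotProduct_mulVec_comm _ _
  have h₃ : Aᵀ.mulVec φ ⬝ᵥ y = φ ⬝ᵥ A.mulVec y := by
    rw [mulVec_transpose, ← dotProduct_mulVec]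
  have h₄ : vecMulVec (P.mulVec B) (P.mulVec B) *ᵥ y
      = (B ⬝ᵥ P.mulVec y) • P.mulVec B := by
    rw [← hP.dotProduct_mulVec_comm, vecMulVec_mulVec, dotProduct_comm]
    simp
  simp only [add_mulVec, sub_mulVec, neg_mulVec, smul_mulVec, mulVec_add, mulVec_smul,
    ← mulVec_mulVec, dotProduct_add, dotProduct_sub, add_dotProduct, sub_dotProduct,
    dotProduct_neg, smul_dotProduct, dotProduct_smul, smul_eq_mul, h₁, h₂, h₃, h₄,
    hP.dotProduct_mulVec_comm y B, hP.dotProduct_mulVec_comm y r,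
    dotProduct_comm (P.mulVec B) y, dotProduct_comm (P.mulVec r) y, dotProduct_comm φ B]
  field_simp
  ring

end RiccatiVerification

/-- **Optimality of the Riccati feedback law for the linear-quadratic problem.**
If `P` solves the matrix Riccati ODE with `P(T) = 0` and `φ` is the associated
affine correction with `φ(T) = 0`, then among all pairs `(Y,V)` solving
`Y′ = AY + V•B̄ + r` from the initial state `y₀`, the pair `(Y*,V*)` satisfying
the feedback law `V*(t) = −R(t)⁻¹ B̄⬝(P(t)Y*(t) + φ(t))` has the least cost
`∫₀ᵀ (Y⬝Q̄Y + R V²)`. -/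
theorem lq_feedback_optimality
    (n : ℕ) (hn : 1 ≤ n) (T : ℝ) (hT : 0 < T)
    (A : Matrix (Fin n) (Fin n) ℝ) (Bb : Fin n → ℝ)
    (Qb : ℝ → Matrix (Fin n) (Fin n) ℝ)
    (hQc : ContinuousOn Qb (Set.Icc 0 T))
    (hQsymm : ∀ t ∈ Set.Icc (0 : ℝ) T, (Qb t).IsSymm)
    (R : ℝ → ℝ) (hRc : ContinuousOn R (Set.Icc 0 T))
    (hRpos : ∀ t ∈ Set.Icc (0 : ℝ) T, 0 < R t)
    (r : ℝ → Fin n → ℝ) (hrc : ContinuousOn r (Set.Icc 0 T))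
    (P : ℝ → Matrix (Fin n) (Fin n) ℝ)
    (hPsymm : ∀ t ∈ Set.Icc (0 : ℝ) T, (P t).IsSymm) (hPT : P T = 0)
    (hP : ∀ t ∈ Set.Icc (0 : ℝ) T,
      HasDerivWithinAt P
        (-(Aᵀ * P t) - P t * A - Qb t
          + (R t)⁻¹ • Matrix.vecMulVec ((P t).mulVec Bb) ((P t).mulVec Bb))
        (Set.Icc 0 T) t)
    (φ : ℝ → Fin n → ℝ) (hφT : φ T = 0)
    (hφ : ∀ t ∈ Set.Icc (0 : ℝ) T,
      HasDerivWithinAt φ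
        (((R t)⁻¹ * (Bb ⬝ᵥ φ t)) • (P t).mulVec Bb
          - Aᵀ.mulVec (φ t) - (P t).mulVec (r t))
        (Set.Icc 0 T) t)
    (y₀ : Fin n → ℝ)
    (V Vs : ℝ → ℝ) (hV : ContinuousOn V (Set.Icc 0 T))
    (hVs : ContinuousOn Vs (Set.Icc 0 T))
    (Y Ys : ℝ → Fin n → ℝ)
    (hY : ∀ t ∈ Set.Icc (0 : ℝ) T,
      HasDerivWithinAt Y (A.mulVec (Y t) + V t • Bb + r t) (Set.Icc 0 T) t)
    (hYs : ∀ t ∈ Set.Icc (0 : ℝ) T,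
      HasDerivWithinAt Ys (A.mulVec (Ys t) + Vs t • Bb + r t) (Set.Icc 0 T) t)
    (hY0 : Y 0 = y₀) (hYs0 : Ys 0 = y₀)
    (hfeedback : ∀ t ∈ Set.Icc (0 : ℝ) T,
      Vs t = -(R t)⁻¹ * (Bb ⬝ᵥ ((P t).mulVec (Ys t) + φ t))) :
    (∫ t in (0 : ℝ)..T, (Y t ⬝ᵥ (Qb t).mulVec (Y t) + R t * V t ^ 2)) ≥
      ∫ t in (0 : ℝ)..T, (Ys t ⬝ᵥ (Qb t).mulVec (Ys t) + R t * Vs t ^ 2) := by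
  have cont_dot : ∀ {u v : ℝ → Fin n → ℝ}, ContinuousOn u (Set.Icc 0 T) →
      ContinuousOn v (Set.Icc 0 T) → ContinuousOn (fun t => u t ⬝ᵥ v t) (Set.Icc 0 T) :=
    fun hu hv => continuousOn_finsetSum _ fun i _ =>
      (continuousOn_pi.1 hu i).mul (continuousOn_pi.1 hv i)
  have cont_mulVec : ∀ {M : ℝ → Matrix (Fin n) (Fin n) ℝ} {v : ℝ → Fin n → ℝ},
      ContinuousOn M (Set.Icc 0 T) → ContinuousOn v (Set.Icc 0 T) →
      ContinuousOn (fun t => (M t).mulVec (v t)) (Set.Icc 0 T) :=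
    fun {M} _ hM hv => continuousOn_pi.2 fun i =>
      cont_dot ((continuousOn_pi (f := fun t => (M t : Fin n → Fin n → ℝ))).1 hM i) hv
  have hRi : ContinuousOn (fun t => (R t)⁻¹) (Set.Icc 0 T) :=
    hRc.inv₀ fun t ht => (hRpos t ht).ne'
  have hPc : ContinuousOn P (Set.Icc 0 T) := fun t ht => (hP t ht).continuousWithinAt
  have hφc : ContinuousOn φ (Set.Icc 0 T) := fun t ht => (hφ t ht).continuousWithinAt
  have hBc : ContinuousOn (fun _ : ℝ => Bb) (Set.Icc 0 T) := continuousOn_const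
  have integrable : ∀ {f : ℝ → ℝ}, ContinuousOn f (Set.Icc 0 T) →
      IntervalIntegrable f volume 0 T := fun hf =>
    ContinuousOn.intervalIntegrable (by rwa [Set.uIcc_of_le hT.le])
  have cost_eq : ∀ (W : ℝ → ℝ) (X : ℝ → Fin n → ℝ), ContinuousOn W (Set.Icc 0 T) →
      (∀ t ∈ Set.Icc (0 : ℝ) T,
        HasDerivWithinAt X (A.mulVec (X t) + W t • Bb + r t) (Set.Icc 0 T) t) →
      X 0 = y₀ →
      ∫ t in (0 : ℝ)..T, (X t ⬝ᵥ (Qb t).mulVec (X t) + R t * W t ^ 2)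
        = (∫ t in (0 : ℝ)..T,
            R t * (W t + (R t)⁻¹ * (Bb ⬝ᵥ ((P t).mulVec (X t) + φ t))) ^ 2)
          + ((∫ t in (0 : ℝ)..T, (2 * (φ t ⬝ᵥ r t) - (R t)⁻¹ * (Bb ⬝ᵥ φ t) ^ 2))
            + (y₀ ⬝ᵥ (P 0).mulVec y₀ + 2 * (φ 0 ⬝ᵥ y₀))) := by
    intro W X hW hX hX0
    have hXc : ContinuousOn X (Set.Icc 0 T) := fun t ht => (hX t ht).continuousWithinAt
    have hcost : ContinuousOn (fun t => X t ⬝ᵥ (Qb t).mulVec (X t) + R t * W t ^ 2)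
        (Set.Icc 0 T) := (cont_dot hXc (cont_mulVec hQc hXc)).add (hRc.mul (hW.pow 2))
    have hsq : ContinuousOn (fun t =>
        R t * (W t + (R t)⁻¹ * (Bb ⬝ᵥ ((P t).mulVec (X t) + φ t))) ^ 2) (Set.Icc 0 T) :=
      hRc.mul ((hW.add (hRi.mul (cont_dot hBc ((cont_mulVec hPc hXc).add hφc)))).pow 2)
    have hrest : ContinuousOn (fun t => 2 * (φ t ⬝ᵥ r t) - (R t)⁻¹ * (Bb ⬝ᵥ φ t) ^ 2)
        (Set.Icc 0 T) :=
      (continuousOn_const.mul (cont_dot hφc hrc)).sub (hRi.mul ((cont_dot hBc hφc).pow 2))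
    have hvalue : ∀ t ∈ Set.Icc (0 : ℝ) T,
        HasDerivWithinAt (fun t => X t ⬝ᵥ (P t).mulVec (X t) + 2 * (φ t ⬝ᵥ X t))
          (R t * (W t + (R t)⁻¹ * (Bb ⬝ᵥ ((P t).mulVec (X t) + φ t))) ^ 2
            + (2 * (φ t ⬝ᵥ r t) - (R t)⁻¹ * (Bb ⬝ᵥ φ t) ^ 2)
            - (X t ⬝ᵥ (Qb t).mulVec (X t) + R t * W t ^ 2)) (Set.Icc 0 T) t := by
      intro t ht
      rw [← riccati_completion_of_square A (P t) (Qb t) (hPsymm t ht) Bb (r t) (φ t) (X t)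
        (R t) (W t) (hRpos t ht).ne', add_sub_cancel_right]
      exact ((hX t ht).dotProduct ((hP t ht).mulVec (hX t ht))).add
        (((hφ t ht).dotProduct (hX t ht)).const_mul 2)
    have hFTC := integral_eq_sub_of_hasDerivAt_of_le hT.le
      (fun t ht => (hvalue t ht).continuousWithinAt)
      (fun t ht => (hvalue t (Set.Ioo_subset_Icc_self ht)).hasDerivAt (Icc_mem_nhds ht.1 ht.2))
      (integrable ((hsq.add hrest).sub hcost))
    rw [integral_sub (integrable (hsq.fun_add hrest)) (integrable hcost),
      integral_add (integrable hsq) (integrable hrest)] at hFTC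
    simp only [hPT, hφT, hX0, zero_mulVec, dotProduct_zero, zero_dotProduct] at hFTC
    linarith
  rw [ge_iff_le, cost_eq V Y hV hY hY0, cost_eq Vs Ys hVs hYs hYs0]
  gcongr
  have hzero : ∫ t in (0 : ℝ)..T,
      R t * (Vs t + (R t)⁻¹ * (Bb ⬝ᵥ ((P t).mulVec (Ys t) + φ t))) ^ 2 = 0 := by
    rw [integral_congr (g := fun _ => (0 : ℝ)), intervalIntegral.integral_zero]
    intro t ht
    rw [Set.uIcc_of_le hT.le] at ht
    simp [hfeedback t ht]
  rw [hzero]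
  exact integral_nonneg hT.le fun t ht => mul_nonneg (hRpos t ht).le (sq_nonneg _)
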